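/- arXiv:2308.08026 — 6 statements merged into one kernel-verified Lean document; each statement's English description precedes it below -/
import Mathlib

section
/- Let X and Y be ℂ-vector spaces. The map sending a B-linear map φ : B⊗̂X → B⊗̂Y to its restriction along the canonical embedding X → B⊗̂X (x ↦ 1 ⊗ x) is a bijection between the set of B-linear maps B⊗̂X → B⊗̂Y and the set of ℂ-linear maps X → B⊗̂Y; that is, every ℂ-linear map X → B⊗̂Y extends uniquely to a B-linear map B⊗̂X → B⊗̂Y. -/
/-!
`B` is a "deformation base": a commutative Noetherian local ℂ-algebra, complete in the
`𝔪`-adic topology, with residue field `ℂ`.  For a ℂ-vector space `X`, the completed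
tensor product `B ⊗̂ X` is the `𝔪`-adic completion of `B ⊗[ℂ] X`, realized as the
inverse limit of the modules `(B ⊗[ℂ] X) ⧸ 𝔪^k (B ⊗[ℂ] X) ≅ B/𝔪^k ⊗[ℂ] X`.
-/

open scoped TensorProduct
open IsLocalRing

/-- The completed tensor product `B ⊗̂ X`. -/
noncomputable abbrev CTP (B : Type) [CommRing B] [Algebra ℂ B] [IsLocalRing B]
    (X : Type) [AddCommGroup X] [Module ℂ X] : Type :=
  AdicCompletion (maximalIdeal B) (B ⊗[ℂ] X)

/-- The canonical embedding `X → B ⊗̂ X`, `x ↦ 1 ⊗ x`. -/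
noncomputable def iota (B : Type) [CommRing B] [Algebra ℂ B] [IsLocalRing B]
    (X : Type) [AddCommGroup X] [Module ℂ X] (x : X) : CTP B X :=
  AdicCompletion.of (maximalIdeal B) (B ⊗[ℂ] X) ((1 : B) ⊗ₜ x)

/-- The submodule `𝔪^k X ⊆ B ⊗̂ X`: the kernel of the canonical projection
`B ⊗̂ X → (B ⊗[ℂ] X) ⧸ 𝔪^k (B ⊗[ℂ] X) ≅ B/𝔪^k ⊗[ℂ] X`. -/
noncomputable def mpow (B : Type) [CommRing B] [Algebra ℂ B] [IsLocalRing B]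
    (X : Type) [AddCommGroup X] [Module ℂ X] (k : ℕ) : Submodule B (CTP B X) :=
  LinearMap.ker (AdicCompletion.eval (maximalIdeal B) (B ⊗[ℂ] X) k)

/-- The `𝔪`-adic topology on `B ⊗̂ X`, generated by the cosets `x + 𝔪^k X`. -/
noncomputable def adicTop (B : Type) [CommRing B] [Algebra ℂ B] [IsLocalRing B]
    (X : Type) [AddCommGroup X] [Module ℂ X] : TopologicalSpace (CTP B X) :=
  TopologicalSpace.generateFrom
    {s | ∃ (x : CTP B X) (k : ℕ), s = {y | y - x ∈ mpow B X k}}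

namespace AdicCompletion

variable {R : Type*} [CommRing R] {I : Ideal R} {M N : Type*} [AddCommGroup M] [Module R M]
  [AddCommGroup N] [Module R N]

/-- For finitely generated `I`, linear maps from the `I`-adic completion of `M` to an `I`-adically
Hausdorff module are determined by their values on the image of `M`. -/
theorem linearMap_ext_of_fg (hI : I.FG) [IsHausdorff I N] {φ ψ : AdicCompletion I M →ₗ[R] N}
    (h : ∀ m, φ (of I M m) = ψ (of I M m)) : φ = ψ := by
  refine LinearMap.ext fun x ↦ ?_
  rw [IsHausdorff.eq_iff_smodEq (I := I)]
  intro n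
  obtain ⟨m, hm⟩ := Submodule.mkQ_surjective _ (eval I M n x)
  have hx : x - of I M m ∈ (I ^ n • ⊤ : Submodule R (AdicCompletion I M)) := by
    rw [pow_smul_top_eq_ker_eval hI, LinearMap.mem_ker, map_sub, eval_of, hm, sub_self]
  have hd : (φ - ψ) (x - of I M m) = φ x - ψ x := by
    simp [h m]
  rw [SModEq.sub_mem, ← hd]
  have hmap := Submodule.mem_map_of_mem (f := φ - ψ) hx
  rw [Submodule.map_smul''] at hmap
  exact Submodule.smul_mono le_rfl le_top hmap

/-- For finitely generated `I`, every linear map from `M` to an `I`-adically complete module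
extends uniquely to the `I`-adic completion of `M`. -/
theorem existsUnique_extension_of_fg (hI : I.FG) [IsAdicComplete I N] (g : M →ₗ[R] N) :
    ∃! φ : AdicCompletion I M →ₗ[R] N, ∀ m, φ (of I M m) = g m := by
  refine ⟨(ofLinearEquiv I N).symm.toLinearMap ∘ₗ (map I g).restrictScalars R, fun m ↦ ?_,
    fun ψ hψ ↦ linearMap_ext_of_fg hI fun m ↦ ?_⟩
  · simp [map_of]
  · simp [hψ m, map_of]

end AdicCompletion

/-- Restriction along the canonical embedding `X → B ⊗̂ X` is a bijection
between `B`-linear maps `B ⊗̂ X → B ⊗̂ Y` and ℂ-linear maps `X → B ⊗̂ Y`: every ℂ-linear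
map `f : X → B ⊗̂ Y` (ℂ acting on `B ⊗̂ Y` through `algebraMap ℂ B`) extends uniquely to a
`B`-linear map `B ⊗̂ X → B ⊗̂ Y`. -/
theorem blinear_extension_unique_bijection
    (B : Type) [CommRing B] [Algebra ℂ B] [IsNoetherianRing B] [IsLocalRing B]
    [IsAdicComplete (maximalIdeal B) B]
    (hres : Function.Bijective (algebraMap ℂ (ResidueField B)))
    (X Y : Type) [AddCommGroup X] [Module ℂ X] [AddCommGroup Y] [Module ℂ Y]
    (f : X → CTP B Y)
    (hadd : ∀ x y : X, f (x + y) = f x + f y)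
    (hsmul : ∀ (c : ℂ) (x : X), f (c • x) = (algebraMap ℂ B c) • f x) :
    ∃! φ : CTP B X →ₗ[B] CTP B Y, ∀ x : X, φ (iota B X x) = f x := by
  have hfg : (maximalIdeal B).FG := IsNoetherian.noetherian _
  have : IsAdicComplete (maximalIdeal B) (CTP B Y) := AdicCompletion.isAdicComplete hfg
  let l : X →ₗ[ℂ] CTP B Y :=
    { toFun := f
      map_add' := hadd
      map_smul' := fun c x ↦ by rw [hsmul, algebraMap_smul, RingHom.id_apply] }
  obtain ⟨φ, hφ, huniq⟩ :=
    AdicCompletion.existsUnique_extension_of_fg hfg (l.liftBaseChange B)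
  refine ⟨φ, fun x ↦ (hφ _).trans (l.liftBaseChange_one_tmul B x), fun ψ hψ ↦ huniq ψ fun m ↦ ?_⟩
  have hcomp : ψ ∘ₗ AdicCompletion.of (maximalIdeal B) (B ⊗[ℂ] X) = l.liftBaseChange B := by
    refine TensorProduct.AlgebraTensorModule.curry_injective (LinearMap.ext_ring ?_)
    refine LinearMap.ext fun x ↦ ?_
    exact (hψ x).trans (l.liftBaseChange_one_tmul B x).symm
  exact LinearMap.congr_fun hcomp m
end

section
/- Let X and Y be ℂ-vector spaces and φ : B⊗̂X → B⊗̂Y a B-linear map whose leading term φ₀ : X → Y is injective. Then φ is injective. -/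
/-!
`B` is a "deformation base": a commutative Noetherian local ℂ-algebra, complete in the
`𝔪`-adic topology, with residue field `ℂ`.  For a ℂ-vector space `X`, the completed
tensor product `B ⊗̂ X` is the `𝔪`-adic completion of `B ⊗[ℂ] X`, realized as the
inverse limit of the modules `(B ⊗[ℂ] X) ⧸ 𝔪^k (B ⊗[ℂ] X) ≅ B/𝔪^k ⊗[ℂ] X`.
-/

open scoped TensorProduct
open IsLocalRing

/-- An endomorphism of an `I`-adically separated module that is congruent to the identity
modulo `I` is injective. -/
theorem injective_of_sub_self_mem_smul_top {R M : Type*} [CommRing R] (I : Ideal R)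
    [AddCommGroup M] [Module R M] [IsHausdorff I M] (f : M →ₗ[R] M)
    (hf : ∀ x, f x - x ∈ (I • ⊤ : Submodule R M)) : Function.Injective f := by
  rw [injective_iff_map_eq_zero]
  intro z hz
  have hmap : (⊤ : Submodule R M).map (f - .id) ≤ I • ⊤ := by
    rintro _ ⟨x, -, rfl⟩
    exact hf x
  have hpow : ∀ n : ℕ, z ∈ (I ^ n • ⊤ : Submodule R M) := by
    intro n
    induction n with
    | zero => simp
    | succ n ih =>
      have h : (f - .id : M →ₗ[R] M) z ∈ (I ^ n • ⊤ : Submodule R M).map (f - .id) :=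
        Submodule.mem_map_of_mem ih
      rw [Submodule.map_smul''] at h
      have h' := Submodule.smul_mono le_rfl hmap h
      rw [← Submodule.mul_smul, ← pow_succ] at h'
      simpa [hz] using h'
  exact IsHausdorff.haus ‹_› z fun n => by
    rw [SModEq.zero]
    exact hpow n

/-- A `B`-linear endomorphism of `B ⊗̂ X` whose leading term is the identity of `X` is the
identity modulo `𝔪 X`. -/
theorem sub_self_mem_mpow_one (B : Type) [CommRing B] [Algebra ℂ B] [IsNoetherianRing B]
    [IsLocalRing B]
    (X : Type) [AddCommGroup X] [Module ℂ X] (f : CTP B X →ₗ[B] CTP B X)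
    (hf : ∀ x : X, f (iota B X x) - iota B X x ∈ mpow B X 1) (z : CTP B X) :
    f z - z ∈ mpow B X 1 := by
  have hm : mpow B X 1 = maximalIdeal B ^ 1 • ⊤ :=
    (AdicCompletion.pow_smul_top_eq_ker_eval (IsNoetherian.noetherian _)).symm
  let g : CTP B X →ₗ[B] CTP B X := f - LinearMap.id
  have hof : ∀ t : B ⊗[ℂ] X,
      g (AdicCompletion.of (maximalIdeal B) (B ⊗[ℂ] X) t) ∈ mpow B X 1 := by
    intro t
    induction t with
    | zero => simp
    | add a b ha hb =>
      rw [map_add, map_add]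
      exact add_mem ha hb
    | tmul b x =>
      have hb : b ⊗ₜ[ℂ] x = b • ((1 : B) ⊗ₜ[ℂ] x) := by
        rw [TensorProduct.smul_tmul', smul_eq_mul, mul_one]
      rw [hb, map_smul, map_smul]
      exact Submodule.smul_mem _ _ (hf x)
  obtain ⟨t, ht⟩ := Submodule.mkQ_surjective _ (AdicCompletion.eval (maximalIdeal B) _ 1 z)
  have hz : z - AdicCompletion.of (maximalIdeal B) _ t ∈ mpow B X 1 := by
    rw [mpow, LinearMap.mem_ker, map_sub, AdicCompletion.eval_of, ht, sub_self]
  have hz' : g (z - AdicCompletion.of (maximalIdeal B) _ t) ∈ mpow B X 1 := by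
    rw [hm] at hz ⊢
    exact Submodule.smul_top_le_comap_smul_top _ g hz
  have h := add_mem hz' (hof t)
  rwa [← map_add, sub_add_cancel] at h

/-- If the leading term `φ₀ : X → Y` of a `B`-linear map
`φ : B ⊗̂ X → B ⊗̂ Y` is injective, then `φ` is injective.  Here `φ₀` being the leading
term of `φ` means `φ(1 ⊗ x) ≡ 1 ⊗ φ₀(x)  (mod 𝔪 Y)` for all `x ∈ X`, using the
identification `(B ⊗̂ Y)/𝔪Y ≅ Y`. -/
theorem injective_of_leading_term_injective
    (B : Type) [CommRing B] [Algebra ℂ B] [IsNoetherianRing B] [IsLocalRing B]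
    [IsAdicComplete (maximalIdeal B) B]
    (hres : Function.Bijective (algebraMap ℂ (ResidueField B)))
    (X Y : Type) [AddCommGroup X] [Module ℂ X] [AddCommGroup Y] [Module ℂ Y]
    (φ : CTP B X →ₗ[B] CTP B Y) (φ₀ : X →ₗ[ℂ] Y)
    (hlead : ∀ x : X, φ (iota B X x) - iota B Y (φ₀ x) ∈ mpow B Y 1)
    (hinj : Function.Injective φ₀) :
    Function.Injective φ := by
  have hfg : (maximalIdeal B).FG := IsNoetherian.noetherian _
  obtain ⟨ψ, hψ⟩ := φ₀.exists_leftInverse_of_injective (LinearMap.ker_eq_bot.mpr hinj)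
  let Ψ : CTP B Y →ₗ[B] CTP B X :=
    (AdicCompletion.map (maximalIdeal B) (ψ.baseChange B)).restrictScalars B
  have hΨ : ∀ y, Ψ (iota B Y y) = iota B X (ψ y) := fun y => by
    simp only [Ψ, iota, LinearMap.restrictScalars_apply]
    rw [AdicCompletion.map_of, LinearMap.baseChange_tmul]
  have hΨm : ∀ w ∈ mpow B Y 1, Ψ w ∈ mpow B X 1 := by
    intro w hw
    simp only [mpow, ← AdicCompletion.pow_smul_top_eq_ker_eval hfg] at hw ⊢
    exact Submodule.smul_top_le_comap_smul_top _ Ψ hw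
  have hlead' : ∀ x, (Ψ ∘ₗ φ) (iota B X x) - iota B X x ∈ mpow B X 1 := by
    intro x
    have h := hΨm _ (hlead x)
    rwa [map_sub, hΨ, ← LinearMap.comp_apply ψ, hψ, LinearMap.id_apply] at h
  have hcomp : Function.Injective (Ψ ∘ₗ φ) := by
    have := AdicCompletion.isAdicComplete (M := B ⊗[ℂ] X) hfg
    refine injective_of_sub_self_mem_smul_top (maximalIdeal B) _ fun z => ?_
    have h := sub_self_mem_mpow_one B X _ hlead' z
    rwa [mpow, ← AdicCompletion.pow_smul_top_eq_ker_eval hfg, pow_one] at h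
  rw [LinearMap.coe_comp] at hcomp
  exact hcomp.of_comp
end

section
/- Let X and Y be ℂ-vector spaces and φ : B⊗̂X → B⊗̂Y a B-linear map whose leading term φ₀ : X → Y is injective. Then for every k ∈ ℕ and every x ∈ B⊗̂X, if φ(x) ∈ 𝔪^k Y then x ∈ 𝔪^k X; consequently φ is a topological embedding of B⊗̂X onto its image (with the subspace topology from the 𝔪-adic topology on B⊗̂Y). -/
/-!
`B` is a "deformation base": a commutative Noetherian local ℂ-algebra, complete in the
`𝔪`-adic topology, with residue field `ℂ`.  For a ℂ-vector space `X`, the completed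
tensor product `B ⊗̂ X` is the `𝔪`-adic completion of `B ⊗[ℂ] X`, realized as the
inverse limit of the modules `(B ⊗[ℂ] X) ⧸ 𝔪^k (B ⊗[ℂ] X) ≅ B/𝔪^k ⊗[ℂ] X`.
-/

open scoped TensorProduct
open IsLocalRing

theorem map_mem_smul_top {R M N : Type*} [CommRing R] [AddCommGroup M] [Module R M]
    [AddCommGroup N] [Module R N] (f : M →ₗ[R] N) {I : Ideal R} {m : M}
    (hm : m ∈ (I • ⊤ : Submodule R M)) : f m ∈ (I • ⊤ : Submodule R N) :=
  Submodule.smul_top_le_comap_smul_top I f hm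

section Filtration

variable {B : Type} [CommRing B] [Algebra ℂ B] [IsLocalRing B]
  {X Y : Type} [AddCommGroup X] [Module ℂ X] [AddCommGroup Y] [Module ℂ Y]

theorem mpow_eq_pow_smul_top [IsNoetherianRing B] (k : ℕ) :
    mpow B X k = maximalIdeal B ^ k • ⊤ :=
  (AdicCompletion.pow_smul_top_eq_ker_eval (maximalIdeal B).fg_of_isNoetherianRing).symm

theorem of_mem_mpow_iff {k : ℕ} {m : B ⊗[ℂ] X} :
    AdicCompletion.of (maximalIdeal B) (B ⊗[ℂ] X) m ∈ mpow B X k ↔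
      m ∈ (maximalIdeal B ^ k • ⊤ : Submodule B (B ⊗[ℂ] X)) := by
  rw [mpow, LinearMap.mem_ker, AdicCompletion.eval_of, Submodule.mkQ_apply,
    Submodule.Quotient.mk_eq_zero]

theorem exists_sub_of_mem_mpow (k : ℕ) (x : CTP B X) :
    ∃ m : B ⊗[ℂ] X, x - AdicCompletion.of (maximalIdeal B) (B ⊗[ℂ] X) m ∈ mpow B X k := by
  obtain ⟨m, hm⟩ := Submodule.mkQ_surjective _ (AdicCompletion.eval (maximalIdeal B) _ k x)
  refine ⟨m, ?_⟩
  rw [mpow, LinearMap.mem_ker, map_sub, AdicCompletion.eval_of, hm, sub_self]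

theorem mpow_antitone [IsNoetherianRing B] : Antitone (mpow B X) := fun _ _ h => by
  rw [mpow_eq_pow_smul_top, mpow_eq_pow_smul_top]
  exact Submodule.smul_mono_left (Ideal.pow_le_pow_right h)

theorem mem_mpow_zero [IsNoetherianRing B] (x : CTP B X) : x ∈ mpow B X 0 := by
  simp [mpow_eq_pow_smul_top]

theorem eq_zero_of_forall_mem_mpow {x : CTP B X} (h : ∀ k, x ∈ mpow B X k) : x = 0 :=
  AdicCompletion.ext fun k => by simpa [mpow] using h k

theorem smul_mem_mpow_succ [IsNoetherianRing B] {k : ℕ} {b : B} (hb : b ∈ maximalIdeal B ^ k)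
    {x : CTP B X} (hx : x ∈ mpow B X 1) : b • x ∈ mpow B X (k + 1) := by
  rw [mpow_eq_pow_smul_top] at hx ⊢
  rw [pow_add, ← smul_eq_mul, Submodule.smul_assoc]
  exact Submodule.smul_mem_smul hb hx

theorem map_mem_mpow [IsNoetherianRing B] (φ : CTP B X →ₗ[B] CTP B Y) {k : ℕ} {x : CTP B X}
    (hx : x ∈ mpow B X k) : φ x ∈ mpow B Y k := by
  rw [mpow_eq_pow_smul_top] at hx ⊢
  exact map_mem_smul_top φ hx

theorem map_of_sub_of_baseChange_mem_mpow_one (φ : CTP B X →ₗ[B] CTP B Y) (φ₀ : X →ₗ[ℂ] Y)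
    (hlead : ∀ x : X, φ (iota B X x) - iota B Y (φ₀ x) ∈ mpow B Y 1) (m : B ⊗[ℂ] X) :
    φ (AdicCompletion.of (maximalIdeal B) _ m) -
      AdicCompletion.of (maximalIdeal B) _ (φ₀.baseChange B m) ∈ mpow B Y 1 := by
  induction m with
  | zero => simp
  | tmul b x =>
    have h := (mpow B Y 1).smul_mem b (hlead x)
    rw [iota, iota, smul_sub, ← map_smul, ← map_smul, ← map_smul, TensorProduct.smul_tmul',
      TensorProduct.smul_tmul', smul_eq_mul, mul_one] at h
    exact h
  | add m n hm hn =>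
    simp only [map_add, add_sub_add_comm]
    exact add_mem hm hn

theorem map_of_sub_of_baseChange_mem_mpow_succ [IsNoetherianRing B]
    (φ : CTP B X →ₗ[B] CTP B Y) (φ₀ : X →ₗ[ℂ] Y)
    (hlead : ∀ x : X, φ (iota B X x) - iota B Y (φ₀ x) ∈ mpow B Y 1) {k : ℕ} {m : B ⊗[ℂ] X}
    (hm : m ∈ (maximalIdeal B ^ k • ⊤ : Submodule B (B ⊗[ℂ] X))) :
    φ (AdicCompletion.of (maximalIdeal B) _ m) -
      AdicCompletion.of (maximalIdeal B) _ (φ₀.baseChange B m) ∈ mpow B Y (k + 1) := by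
  induction hm using Submodule.smul_induction_on' with
  | smul b hb n _ =>
    simp only [map_smul, ← smul_sub]
    exact smul_mem_mpow_succ hb (map_of_sub_of_baseChange_mem_mpow_one φ φ₀ hlead n)
  | add m _ n _ hm hn =>
    simp only [map_add, add_sub_add_comm]
    exact add_mem hm hn

theorem mem_smul_top_of_baseChange_mem_smul_top {φ₀ : X →ₗ[ℂ] Y} (hinj : Function.Injective φ₀)
    {I : Ideal B} {m : B ⊗[ℂ] X} (hm : φ₀.baseChange B m ∈ (I • ⊤ : Submodule B (B ⊗[ℂ] Y))) :
    m ∈ (I • ⊤ : Submodule B (B ⊗[ℂ] X)) := by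
  obtain ⟨ψ, hψ⟩ := φ₀.exists_leftInverse_of_injective (LinearMap.ker_eq_bot.2 hinj)
  have h := map_mem_smul_top (ψ.baseChange B) hm
  rwa [← LinearMap.comp_apply, ← LinearMap.baseChange_comp, hψ, LinearMap.baseChange_id,
    LinearMap.id_apply] at h

theorem mem_mpow_of_map_mem_mpow [IsNoetherianRing B]
    (φ : CTP B X →ₗ[B] CTP B Y) (φ₀ : X →ₗ[ℂ] Y)
    (hlead : ∀ x : X, φ (iota B X x) - iota B Y (φ₀ x) ∈ mpow B Y 1)
    (hinj : Function.Injective φ₀) (k : ℕ) (x : CTP B X) (hx : φ x ∈ mpow B Y k) :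
    x ∈ mpow B X k := by
  induction k with
  | zero => exact mem_mpow_zero x
  | succ k ih =>
    have hxk := ih (mpow_antitone k.le_succ hx)
    obtain ⟨m, hm⟩ := exists_sub_of_mem_mpow (k + 1) x
    have hmk : m ∈ (maximalIdeal B ^ k • ⊤ : Submodule B (B ⊗[ℂ] X)) :=
      of_mem_mpow_iff.1 (((mpow B X k).sub_mem_iff_right hxk).1 (mpow_antitone k.le_succ hm))
    have hφm : φ (AdicCompletion.of (maximalIdeal B) _ m) ∈ mpow B Y (k + 1) := by
      have h := map_mem_mpow φ hm
      rw [map_sub] at h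
      exact ((mpow B Y (k + 1)).sub_mem_iff_right hx).1 h
    have hbc := ((mpow B Y (k + 1)).sub_mem_iff_right hφm).1
      (map_of_sub_of_baseChange_mem_mpow_succ φ φ₀ hlead hmk)
    have hmk' := of_mem_mpow_iff.2
      (mem_smul_top_of_baseChange_mem_smul_top hinj (of_mem_mpow_iff.1 hbc))
    exact ((mpow B X (k + 1)).sub_mem_iff_left hmk').1 hm

theorem continuous_adicTop [IsNoetherianRing B] (φ : CTP B X →ₗ[B] CTP B Y) :
    @Continuous _ _ (adicTop B X) (adicTop B Y) φ := by
  let _ := adicTop B X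
  refine continuous_generateFrom_iff.2 ?_
  rintro _ ⟨y, k, rfl⟩
  refine isOpen_iff_forall_mem_open.2 fun x hx =>
    ⟨{z | z - x ∈ mpow B X k}, fun z hz => ?_,
      TopologicalSpace.isOpen_generateFrom_of_mem ⟨x, k, rfl⟩, by simp⟩
  have h := add_mem (map_mem_mpow φ hz) hx
  rwa [map_sub, sub_add_sub_cancel] at h

theorem isEmbedding_adicTop_of_reflects [IsNoetherianRing B] (φ : CTP B X →ₗ[B] CTP B Y)
    (hφ : ∀ (k : ℕ) (x : CTP B X), φ x ∈ mpow B Y k → x ∈ mpow B X k) :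
    @Topology.IsEmbedding (CTP B X) (CTP B Y) (adicTop B X) (adicTop B Y) φ := by
  let _ := adicTop B X
  let _ := adicTop B Y
  refine ⟨⟨le_antisymm (continuous_adicTop φ).le_induced (le_generateFrom ?_)⟩,
    (injective_iff_map_eq_zero φ).2 fun x hx =>
      eq_zero_of_forall_mem_mpow fun k => hφ k x (hx ▸ zero_mem _)⟩
  rintro _ ⟨x, k, rfl⟩
  refine isOpen_induced_iff.2 ⟨{y | y - φ x ∈ mpow B Y k},
    TopologicalSpace.isOpen_generateFrom_of_mem ⟨φ x, k, rfl⟩, Set.ext fun z => ?_⟩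
  simp only [Set.mem_preimage, Set.mem_ofPred_eq, ← map_sub]
  exact ⟨hφ k _, map_mem_mpow φ⟩

end Filtration

/-- If the leading term `φ₀ : X → Y` of a `B`-linear map
`φ : B ⊗̂ X → B ⊗̂ Y` is injective, then `φ` reflects the `𝔪`-adic filtration
(`φ(x) ∈ 𝔪^k Y → x ∈ 𝔪^k X`), and consequently `φ` is a topological embedding of
`B ⊗̂ X` onto its image, for the `𝔪`-adic topologies. -/
theorem filtration_reflecting_and_embedding_of_leading_term_injective
    (B : Type) [CommRing B] [Algebra ℂ B] [IsNoetherianRing B] [IsLocalRing B]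
    [IsAdicComplete (maximalIdeal B) B]
    (hres : Function.Bijective (algebraMap ℂ (ResidueField B)))
    (X Y : Type) [AddCommGroup X] [Module ℂ X] [AddCommGroup Y] [Module ℂ Y]
    (φ : CTP B X →ₗ[B] CTP B Y) (φ₀ : X →ₗ[ℂ] Y)
    (hlead : ∀ x : X, φ (iota B X x) - iota B Y (φ₀ x) ∈ mpow B Y 1)
    (hinj : Function.Injective φ₀) :
    (∀ (k : ℕ) (x : CTP B X), φ x ∈ mpow B Y k → x ∈ mpow B X k) ∧
    @Topology.IsEmbedding (CTP B X) (CTP B Y) (adicTop B X) (adicTop B Y) φ := by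
  have hφ := mem_mpow_of_map_mem_mpow φ φ₀ hlead hinj
  exact ⟨hφ, isEmbedding_adicTop_of_reflects φ hφ⟩
end

section
/- Let X and Y be ℂ-vector spaces and φ : B⊗̂X → B⊗̂Y a B-linear map whose leading term φ₀ : X → Y is bijective. Then φ is bijective, i.e., an isomorphism of B-modules. -/
/-!
`B` is a "deformation base": a commutative Noetherian local ℂ-algebra, complete in the
`𝔪`-adic topology, with residue field `ℂ`.  For a ℂ-vector space `X`, the completed
tensor product `B ⊗̂ X` is the `𝔪`-adic completion of `B ⊗[ℂ] X`, realized as the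
inverse limit of the modules `(B ⊗[ℂ] X) ⧸ 𝔪^k (B ⊗[ℂ] X) ≅ B/𝔪^k ⊗[ℂ] X`.
-/

open scoped TensorProduct
open IsLocalRing

/-- An endomorphism of an `I`-adically complete module that is congruent to the identity
modulo `I` is bijective. -/
theorem LinearMap.bijective_of_sub_mem_smul_top {R P : Type*} [CommRing R] (I : Ideal R)
    [AddCommGroup P] [Module R P] [IsAdicComplete I P] (f : P →ₗ[R] P)
    (h : ∀ x, x - f x ∈ (I • ⊤ : Submodule R P)) : Function.Bijective f := by
  constructor
  · rw [injective_iff_map_eq_zero]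
    intro x hx
    have key : ∀ n : ℕ, ∀ y ∈ (I ^ n • ⊤ : Submodule R P),
        y - f y ∈ (I ^ (n + 1) • ⊤ : Submodule R P) := by
      intro n y hy
      have hle : (I ^ n • ⊤ : Submodule R P).map (LinearMap.id - f) ≤ I ^ (n + 1) • ⊤ := by
        rw [Submodule.map_smul'', pow_succ, Submodule.mul_smul]
        refine Submodule.smul_mono le_rfl ?_
        rintro _ ⟨z, -, rfl⟩
        exact h z
      exact hle ⟨y, hy, rfl⟩
    have hmem : ∀ n : ℕ, x ∈ (I ^ n • ⊤ : Submodule R P) := by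
      intro n
      induction n with
      | zero => simp
      | succ n ih => simpa [hx] using key n x ih
    exact IsHausdorff.haus (I := I) inferInstance x fun n ↦ SModEq.zero.2 (hmem n)
  · refine surjective_of_mkQ_comp_surjective (I := I) fun y ↦ ?_
    obtain ⟨x, rfl⟩ := Submodule.mkQ_surjective _ y
    refine ⟨x, ?_⟩
    rw [LinearMap.comp_apply, eq_comm, Submodule.mkQ_apply, Submodule.mkQ_apply,
      Submodule.Quotient.eq]
    exact h x

/-- A linear map out of an adic completion sends everything into `I • ⊤` as soon as it does so
on the image of the original module. -/
theorem AdicCompletion.apply_mem_smul_top {R M N : Type*} [CommRing R] {I : Ideal R}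
    (hI : I.FG) [AddCommGroup M] [Module R M] [AddCommGroup N] [Module R N]
    (f : AdicCompletion I M →ₗ[R] N)
    (h : ∀ m, f (AdicCompletion.of I M m) ∈ (I • ⊤ : Submodule R N)) (x : AdicCompletion I M) :
    f x ∈ (I • ⊤ : Submodule R N) := by
  obtain ⟨m, hm⟩ := Submodule.mkQ_surjective _ (AdicCompletion.eval I M 1 x)
  have hx : x - AdicCompletion.of I M m ∈ (I • ⊤ : Submodule R (AdicCompletion I M)) := by
    have hker : x - AdicCompletion.of I M m ∈ (AdicCompletion.eval I M 1).ker := by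
      rw [LinearMap.mem_ker, map_sub, ← hm, sub_eq_zero]
      rfl
    rwa [← AdicCompletion.pow_smul_top_eq_ker_eval hI, pow_one] at hker
  have hle : (I • ⊤ : Submodule R (AdicCompletion I M)).map f ≤ I • ⊤ := by
    rw [Submodule.map_smul'']
    exact Submodule.smul_mono le_rfl le_top
  have hsub : f (x - AdicCompletion.of I M m) ∈ (I • ⊤ : Submodule R N) := hle ⟨_, hx, rfl⟩
  simpa using add_mem hsub (h m)

/-- If the leading term `φ₀ : X → Y` of a `B`-linear map
`φ : B ⊗̂ X → B ⊗̂ Y` is bijective, then `φ` is bijective, i.e. an isomorphism of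
`B`-modules. -/
theorem bijective_of_leading_term_bijective
    (B : Type) [CommRing B] [Algebra ℂ B] [IsNoetherianRing B] [IsLocalRing B]
    [IsAdicComplete (maximalIdeal B) B]
    (hres : Function.Bijective (algebraMap ℂ (ResidueField B)))
    (X Y : Type) [AddCommGroup X] [Module ℂ X] [AddCommGroup Y] [Module ℂ Y]
    (φ : CTP B X →ₗ[B] CTP B Y) (φ₀ : X →ₗ[ℂ] Y)
    (hlead : ∀ x : X, φ (iota B X x) - iota B Y (φ₀ x) ∈ mpow B Y 1)
    (hbij : Function.Bijective φ₀) :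
    Function.Bijective φ := by
  have hI : (maximalIdeal B).FG := IsNoetherian.noetherian _
  have : IsAdicComplete (maximalIdeal B) (CTP B X) := AdicCompletion.isAdicComplete hI
  let e : (B ⊗[ℂ] X) ≃ₗ[B] (B ⊗[ℂ] Y) := (LinearEquiv.ofBijective φ₀ hbij).baseChange ℂ B X Y
  let Ψ : CTP B X ≃ₗ[B] CTP B Y := (AdicCompletion.congr (maximalIdeal B) e).restrictScalars B
  have hΨ : ∀ x, Ψ (iota B X x) = iota B Y (φ₀ x) := by
    intro x
    change AdicCompletion.map (maximalIdeal B) e.toLinearMap (AdicCompletion.of _ _ _) = _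
    rw [AdicCompletion.map_of]
    simp [e, iota]
  have hdiff : ∀ u, (φ - Ψ.toLinearMap) u ∈ (maximalIdeal B • ⊤ : Submodule B (CTP B Y)) := by
    refine AdicCompletion.apply_mem_smul_top hI _ fun m ↦ ?_
    induction m with
    | zero => simp
    | add a b ha hb =>
      rw [map_add, map_add]
      exact add_mem ha hb
    | tmul b x =>
      have hb : AdicCompletion.of (maximalIdeal B) (B ⊗[ℂ] X) (b ⊗ₜ x) = b • iota B X x := by
        rw [iota, ← map_smul, TensorProduct.smul_tmul', smul_eq_mul, mul_one]
      rw [hb, map_smul]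
      refine Submodule.smul_mem _ _ ?_
      have hx := hlead x
      rw [mpow, ← AdicCompletion.pow_smul_top_eq_ker_eval hI, pow_one, ← hΨ] at hx
      exact hx
  have hθ : Function.Bijective (Ψ.symm.toLinearMap ∘ₗ φ) := by
    refine LinearMap.bijective_of_sub_mem_smul_top (maximalIdeal B) _ fun u ↦ ?_
    have hle : (maximalIdeal B • ⊤ : Submodule B (CTP B Y)).map Ψ.symm.toLinearMap ≤
        maximalIdeal B • ⊤ := by
      rw [Submodule.map_smul'']
      exact Submodule.smul_mono le_rfl le_top
    have hu : Ψ.symm ((φ - Ψ.toLinearMap) u) ∈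
        (maximalIdeal B • ⊤ : Submodule B (CTP B X)) := hle ⟨_, hdiff u, rfl⟩
    simpa using neg_mem hu
  exact (Function.Bijective.of_comp_iff' Ψ.symm.bijective φ).1 hθ
end

section
/- Let M be a module over a commutative ring with an internal direct sum decomposition M = H' ⊕ W ⊕ R' into submodules, and let d : M → M be a linear endomorphism such that d restricts to a module isomorphism from R' onto W and d(H') ⊆ H' ⊕ R'. Let h : M → M be the linear map that vanishes on H' and on R' and equals the inverse isomorphism (d|_{R'})^{-1} : W → R' on W. Then the projection of M onto W along H' ⊕ R' equals d ∘ h, and the projection of M onto R' along H' ⊕ W equals h ∘ d − h ∘ d ∘ d ∘ h. -/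
/-- Let `M = H' ⊕ W ⊕ R'` be an internal direct sum of submodules of a
module `M` over a commutative ring, and `d : M → M` linear with `d` restricting to an
isomorphism `R' ≅ W` and `d(H') ⊆ H' ⊕ R'`.  Let `h : M → M` be the linear map vanishing
on `H'` and `R'` and equal to the inverse isomorphism `(d|_{R'})⁻¹ : W → R'` on `W`.
Then the projection onto `W` along `H' ⊕ R'` is `d ∘ h`, and the projection onto `R'`
along `H' ⊕ W` is `h ∘ d - h ∘ d ∘ d ∘ h`. -/
theorem projection_formulas
    (A M : Type) [CommRing A] [AddCommGroup M] [Module A M]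
    (H' W R' : Submodule A M)
    (hsup : H' ⊔ W ⊔ R' = ⊤)
    (hdisjH : Disjoint H' (W ⊔ R')) (hdisjWR : Disjoint W R')
    (d h : M →ₗ[A] M)
    (hdR : Submodule.map d R' = W)
    (hdRinj : Set.InjOn d R')
    (hdH : ∀ x ∈ H', d x ∈ H' ⊔ R')
    (hhH : ∀ x ∈ H', h x = 0)
    (hhR : ∀ x ∈ R', h x = 0)
    (hhW : ∀ w ∈ W, h w ∈ R' ∧ d (h w) = w)
    (πW πR : M →ₗ[A] M)
    (hπW : ∀ x, πW x ∈ W ∧ x - πW x ∈ H' ⊔ R')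
    (hπR : ∀ x, πR x ∈ R' ∧ x - πR x ∈ H' ⊔ W) :
    (∀ x, πW x = d (h x)) ∧ (∀ x, πR x = h (d x) - h (d (d (h x)))) := by
  have hhHR : ∀ y ∈ H' ⊔ R', h y = 0 := by
    intro y hy
    obtain ⟨a, ha, r, hr, rfl⟩ := Submodule.mem_sup.1 hy
    rw [map_add, hhH a ha, hhR r hr, add_zero]
  have hhd : ∀ r ∈ R', h (d r) = r := by
    intro r hr
    have hdr : d r ∈ W := hdR ▸ Submodule.mem_map_of_mem hr
    exact hdRinj (hhW _ hdr).1 hr (hhW _ hdr).2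
  refine ⟨fun x => ?_, fun x => ?_⟩
  · obtain ⟨hW, hy⟩ := hπW x
    have hx := hhHR _ hy
    rw [map_sub, sub_eq_zero] at hx
    rw [hx, (hhW _ hW).2]
  · obtain ⟨hr, hy⟩ := hπR x
    obtain ⟨a, ha, w, hw, haw⟩ := Submodule.mem_sup.1 hy
    have hx : x = πR x + (a + w) := by rw [haw]; abel
    have hhx : h x = h w := by
      rw [hx, map_add, map_add, hhR _ hr, hhH a ha, zero_add, zero_add]
    have hhdx : h (d x) = πR x + h (d w) := by
      conv_lhs => rw [hx]
      simp only [map_add]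
      rw [hhd _ hr, hhHR _ (hdH a ha), zero_add]
    rw [hhx, (hhW w hw).2, hhdx, add_sub_cancel_right]
end

section
/- Assume in addition that d_q ∘ d_q = 0, that D = 0, and that H is a finite-dimensional ℂ-vector space. Then the B-module ker(d_q)/range(d_q) is isomorphic to B⊗̂H ≅ B ⊗_ℂ H; in particular it is a finitely generated free, hence projective, B-module. -/
/-!
`B` is a "deformation base": a commutative Noetherian local ℂ-algebra, complete in the
`𝔪`-adic topology, with residue field `ℂ`.  For a ℂ-vector space `X`, the completed
tensor product `B ⊗̂ X` is the `𝔪`-adic completion of `B ⊗[ℂ] X`, realized as the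
inverse limit of the modules `(B ⊗[ℂ] X) ⧸ 𝔪^k (B ⊗[ℂ] X) ≅ B/𝔪^k ⊗[ℂ] X`.
-/

open scoped TensorProduct
open IsLocalRing

/-- For a ℂ-subspace `W ⊆ V`, the `B`-submodule `B ⊗̂ W ⊆ B ⊗̂ V`: those elements all of
whose finite-level components `(B ⊗[ℂ] V) ⧸ 𝔪^n (B ⊗[ℂ] V)` come from `B ⊗[ℂ] W`. -/
noncomputable def csub (B : Type) [CommRing B] [Algebra ℂ B] [IsLocalRing B]
    (V : Type) [AddCommGroup V] [Module ℂ V] (W : Submodule ℂ V) :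
    Submodule B (CTP B V) :=
  ⨅ n : ℕ, Submodule.comap
    (AdicCompletion.eval (maximalIdeal B) (B ⊗[ℂ] V) n)
    (LinearMap.range ((Submodule.mkQ ((maximalIdeal B) ^ n • ⊤)).comp
      ((W.subtype).baseChange B)))

/-- The cohomology `ker f ⧸ range f` of an operator `f` with (in the intended
application) `f ∘ f = 0`. -/
noncomputable def LinCohomology (A M : Type) [CommRing A] [AddCommGroup M] [Module A M]
    (f : M →ₗ[A] M) : Type :=
  ↥(LinearMap.ker f) ⧸ Submodule.comap (LinearMap.ker f).subtype (LinearMap.range f)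

noncomputable instance (A M : Type) [CommRing A] [AddCommGroup M] [Module A M]
    (f : M →ₗ[A] M) : AddCommGroup (LinCohomology A M f) :=
  inferInstanceAs (AddCommGroup
    (↥(LinearMap.ker f) ⧸ Submodule.comap (LinearMap.ker f).subtype (LinearMap.range f)))

noncomputable instance (A M : Type) [CommRing A] [AddCommGroup M] [Module A M]
    (f : M →ₗ[A] M) : Module A (LinCohomology A M f) :=
  inferInstanceAs (Module A
    (↥(LinearMap.ker f) ⧸ Submodule.comap (LinearMap.ker f).subtype (LinearMap.range f)))

/-- On an `I`-adically complete module, an endomorphism congruent to the identity modulo `I`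
is bijective. -/
theorem bijective_of_sub_self_mem_smul_top {A M : Type*} [CommRing A] [AddCommGroup M]
    [Module A M] (I : Ideal A) [IsAdicComplete I M] (f : M →ₗ[A] M)
    (hf : ∀ x, f x - x ∈ (I • ⊤ : Submodule A M)) : Function.Bijective f := by
  have hstep : ∀ (n : ℕ) (x : M), x ∈ (I ^ n • ⊤ : Submodule A M) →
      f x - x ∈ (I ^ (n + 1) • ⊤ : Submodule A M) := by
    intro n x hx
    have h1 : (I ^ n • ⊤ : Submodule A M).map (f - LinearMap.id) ≤ I ^ (n + 1) • ⊤ := by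
      rw [Submodule.map_smul'', pow_succ, Submodule.mul_smul]
      refine smul_mono_right _ ?_
      rintro _ ⟨y, -, rfl⟩
      exact hf y
    exact h1 ⟨x, hx, rfl⟩
  constructor
  · rw [← LinearMap.ker_eq_bot, LinearMap.ker_eq_bot']
    intro x hx
    refine IsHausdorff.haus (I := I) inferInstance x fun n ↦ ?_
    rw [SModEq.zero]
    induction n with
    | zero => simp
    | succ n ih => simpa [hx] using hstep n x ih
  · intro y
    let a : ℕ → M := fun n ↦ (fun x ↦ y + x - f x)^[n] 0
    have ha : ∀ n, a (n + 1) = y + a n - f (a n) := fun n ↦ Function.iterate_succ_apply' _ _ _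
    have hdiff : ∀ n, a (n + 1) - a n ∈ (I ^ n • ⊤ : Submodule A M) := by
      intro n
      induction n with
      | zero => simp
      | succ n ih =>
        have := neg_mem (hstep n _ ih)
        have hfa : f (a n) = y + a n - a (n + 1) := by rw [ha n, sub_sub_cancel]
        rw [map_sub, hfa] at this
        convert this using 1
        rw [ha (n + 1)]
        abel
    have hcauchy : ∀ {m n}, m ≤ n → a m ≡ a n [SMOD (I ^ m • ⊤ : Submodule A M)] := by
      intro m n hmn
      induction n, hmn using Nat.le_induction with
      | base => rfl
      | succ n hmn ih =>
        refine ih.trans (SModEq.symm ?_)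
        rw [SModEq.sub_mem]
        exact Submodule.pow_smul_top_le I M hmn (hdiff n)
    obtain ⟨L, hL⟩ := IsPrecomplete.prec (I := I) inferInstance hcauchy
    refine ⟨L, ?_⟩
    rw [← sub_eq_zero]
    refine IsHausdorff.haus (I := I) inferInstance _ fun n ↦ ?_
    rw [SModEq.zero]
    have h1 : L - a n ∈ (I ^ n • ⊤ : Submodule A M) := SModEq.sub_mem.1 (hL n).symm
    have h2 := Submodule.pow_smul_top_le I M n.le_succ (hstep n _ h1)
    have h3 := sub_mem (add_mem h2 h1) (hdiff n)
    convert h3 using 1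
    rw [ha n, map_sub]
    abel

/-- A submodule `S` maps isomorphically onto the cohomology of `f` through `h ↦ [h - e h]` if
every class has a unique representative of this form. -/
theorem nonempty_linCohomology_equiv {A M : Type} [CommRing A] [AddCommGroup M] [Module A M]
    (f e : M →ₗ[A] M) (S : Submodule A M)
    (hker : ∀ h ∈ S, f (h - e h) = 0)
    (hinj : ∀ h ∈ S, ∀ y, h - e h = f y → h = 0)
    (hsurj : ∀ x, f x = 0 → ∃ h ∈ S, ∃ y, x = h - e h + f y) :
    Nonempty (LinCohomology A M f ≃ₗ[A] S) := by
  let ψ : S →ₗ[A] LinearMap.ker f :=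
    ((LinearMap.id - e) ∘ₗ S.subtype).codRestrict (LinearMap.ker f) fun h ↦
      LinearMap.mem_ker.2 (hker h h.2)
  let φ : S →ₗ[A] LinearMap.ker f ⧸ (LinearMap.range f).comap (LinearMap.ker f).subtype :=
    Submodule.mkQ _ ∘ₗ ψ
  refine ⟨(LinearEquiv.ofBijective φ ⟨?_, ?_⟩).symm⟩
  · rw [← LinearMap.ker_eq_bot, LinearMap.ker_eq_bot']
    intro h hh
    obtain ⟨y, hy⟩ := (Submodule.Quotient.mk_eq_zero _).1 hh
    exact Subtype.ext (hinj h h.2 y hy.symm)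
  · intro c
    obtain ⟨⟨x, hx⟩, rfl⟩ := Submodule.Quotient.mk_surjective _ c
    obtain ⟨h, hS, y, hxy⟩ := hsurj x hx
    refine ⟨⟨h, hS⟩, (Submodule.Quotient.eq _).2 ⟨-y, ?_⟩⟩
    change f (-y) = h - e h - x
    rw [hxy, map_neg]
    abel

section Hat

variable {B : Type} [CommRing B] [Algebra ℂ B] [IsLocalRing B]
  {X Y Z : Type} [AddCommGroup X] [Module ℂ X] [AddCommGroup Y] [Module ℂ Y]
  [AddCommGroup Z] [Module ℂ Z]

variable (B) in
/-- The `B`-linear extension `B ⊗̂ X → B ⊗̂ Y` of a ℂ-linear map `X → Y`. -/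
noncomputable def hat (f : X →ₗ[ℂ] Y) : CTP B X →ₗ[B] CTP B Y :=
  (AdicCompletion.map (maximalIdeal B) (f.baseChange B)).restrictScalars B

theorem eval_hat (f : X →ₗ[ℂ] Y) (n : ℕ) (x : CTP B X) (z : B ⊗[ℂ] X)
    (hz : AdicCompletion.eval (maximalIdeal B) (B ⊗[ℂ] X) n x = Submodule.Quotient.mk z) :
    AdicCompletion.eval (maximalIdeal B) (B ⊗[ℂ] Y) n (hat B f x) =
      Submodule.Quotient.mk (f.baseChange B z) := by
  rw [AdicCompletion.eval_apply] at hz ⊢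
  change LinearMap.reduceModIdeal _ _ (x.val n) = _
  rw [hz]
  rfl

theorem exists_eval_eq (n : ℕ) (x : CTP B X) : ∃ z : B ⊗[ℂ] X,
    AdicCompletion.eval (maximalIdeal B) (B ⊗[ℂ] X) n x = Submodule.Quotient.mk z := by
  obtain ⟨z, hz⟩ := Submodule.Quotient.mk_surjective _
    (AdicCompletion.eval (maximalIdeal B) (B ⊗[ℂ] X) n x)
  exact ⟨z, hz.symm⟩

theorem ctp_ext {x y : CTP B X}
    (h : ∀ n, AdicCompletion.eval (maximalIdeal B) (B ⊗[ℂ] X) n x =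
      AdicCompletion.eval (maximalIdeal B) (B ⊗[ℂ] X) n y) : x = y :=
  AdicCompletion.ext fun n ↦ h n

theorem hat_hat (g : Y →ₗ[ℂ] Z) (f : X →ₗ[ℂ] Y) (x : CTP B X) :
    hat B g (hat B f x) = hat B (g ∘ₗ f) x := by
  refine ctp_ext fun n ↦ ?_
  obtain ⟨z, hz⟩ := exists_eval_eq n x
  rw [eval_hat g n _ _ (eval_hat f n x z hz), eval_hat _ n x z hz, LinearMap.baseChange_comp,
    LinearMap.comp_apply]

theorem hat_add_apply (f g : X →ₗ[ℂ] Y) (x : CTP B X) :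
    hat B (f + g) x = hat B f x + hat B g x := by
  refine ctp_ext fun n ↦ ?_
  obtain ⟨z, hz⟩ := exists_eval_eq n x
  rw [map_add, eval_hat _ n x z hz, eval_hat _ n x z hz, eval_hat _ n x z hz,
    LinearMap.baseChange_add]
  rfl

theorem hat_id_apply (x : CTP B X) : hat B (LinearMap.id : X →ₗ[ℂ] X) x = x := by
  refine ctp_ext fun n ↦ ?_
  obtain ⟨z, hz⟩ := exists_eval_eq n x
  rw [eval_hat _ n x z hz, hz, LinearMap.baseChange_id]
  rfl

theorem hat_zero_apply (x : CTP B X) : hat B (0 : X →ₗ[ℂ] Y) x = 0 := by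
  refine ctp_ext fun n ↦ ?_
  obtain ⟨z, hz⟩ := exists_eval_eq n x
  rw [eval_hat _ n x z hz, LinearMap.baseChange_zero, map_zero]
  rfl

theorem hat_iota (f : X →ₗ[ℂ] Y) (x : X) : hat B f (iota B X x) = iota B Y (f x) := by
  change AdicCompletion.of _ _ (f.baseChange B (1 ⊗ₜ x)) = _
  rw [LinearMap.baseChange_tmul]
  rfl

theorem hat_mem_csub {W : Submodule ℂ Y} (f : X →ₗ[ℂ] Y) (hf : ∀ x, f x ∈ W) (x : CTP B X) :
    hat B f x ∈ csub B Y W := by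
  rw [csub, Submodule.mem_iInf]
  intro n
  obtain ⟨z, hz⟩ := exists_eval_eq n x
  refine ⟨(f.codRestrict W hf).baseChange B z, ?_⟩
  rw [eval_hat _ n x z hz, LinearMap.comp_apply, ← LinearMap.comp_apply (LinearMap.baseChange B _),
    ← LinearMap.baseChange_comp, LinearMap.subtype_comp_codRestrict]
  rfl

theorem hat_eq_hat_of_mem_csub {W : Submodule ℂ X} (f g : X →ₗ[ℂ] Y) (hfg : ∀ w ∈ W, f w = g w)
    {x : CTP B X} (hx : x ∈ csub B X W) : hat B f x = hat B g x := by
  rw [csub, Submodule.mem_iInf] at hx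
  refine ctp_ext fun n ↦ ?_
  obtain ⟨z, hz⟩ := hx n
  have hcomp : f ∘ₗ W.subtype = g ∘ₗ W.subtype := LinearMap.ext fun w ↦ hfg w w.2
  rw [eval_hat f n x _ hz.symm, eval_hat g n x _ hz.symm, ← LinearMap.comp_apply,
    ← LinearMap.baseChange_comp, hcomp, LinearMap.baseChange_comp, LinearMap.comp_apply]

theorem hat_eq_self_of_mem_csub {W : Submodule ℂ X} (f : X →ₗ[ℂ] X) (hf : ∀ w ∈ W, f w = w)
    {x : CTP B X} (hx : x ∈ csub B X W) : hat B f x = x := by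
  rw [hat_eq_hat_of_mem_csub f LinearMap.id hf hx, hat_id_apply]

theorem hat_eq_zero_of_mem_csub {W : Submodule ℂ X} (f : X →ₗ[ℂ] Y) (hf : ∀ w ∈ W, f w = 0)
    {x : CTP B X} (hx : x ∈ csub B X W) : hat B f x = 0 := by
  rw [hat_eq_hat_of_mem_csub f 0 hf hx, hat_zero_apply]

/-- `B ⊗̂ W`, as a submodule of `B ⊗̂ X`, is the completed tensor product with `W`. -/
theorem nonempty_csub_equiv (W : Submodule ℂ X) : Nonempty (csub B X W ≃ₗ[B] CTP B W) := by
  obtain ⟨p, hp⟩ := W.subtype.exists_leftInverse_of_injective W.ker_subtype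
  have hpw : ∀ w (hw : w ∈ W), p w = ⟨w, hw⟩ := fun w hw ↦ LinearMap.congr_fun hp ⟨w, hw⟩
  refine ⟨LinearEquiv.ofLinearMap (hat B p ∘ₗ (csub B X W).subtype)
    ((hat B W.subtype).codRestrict _ (hat_mem_csub _ fun w ↦ w.2)) ?_ ?_⟩
  · refine LinearMap.ext fun x ↦ ?_
    change hat B p (hat B W.subtype x) = x
    rw [hat_hat, hp, hat_id_apply]
  · refine LinearMap.ext fun x ↦ Subtype.ext ?_
    change hat B W.subtype (hat B p x) = x
    rw [hat_hat]
    exact hat_eq_self_of_mem_csub _ (fun w hw ↦ by simp [hpw w hw]) x.2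

/-- For finite-dimensional `X` the completed tensor product is the tensor product. -/
theorem nonempty_ctp_equiv [IsNoetherianRing B] [IsAdicComplete (maximalIdeal B) B]
    [FiniteDimensional ℂ X] : Nonempty (CTP B X ≃ₗ[B] B ⊗[ℂ] X) :=
  ⟨((AdicCompletion.ofTensorProductEquivOfFiniteNoetherian (maximalIdeal B)
      (B ⊗[ℂ] X)).restrictScalars B).symm ≪≫ₗ
    TensorProduct.congr (AdicCompletion.ofLinearEquiv (maximalIdeal B) B).symm
      (LinearEquiv.refl B _) ≪≫ₗ TensorProduct.lid B _⟩

theorem mem_mpow_one [IsNoetherianRing B] {x : CTP B X} :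
    x ∈ mpow B X 1 ↔ x ∈ (maximalIdeal B • ⊤ : Submodule B (CTP B X)) := by
  rw [mpow, ← AdicCompletion.pow_smul_top_eq_ker_eval (maximalIdeal B).fg_of_isNoetherianRing,
    pow_one]

/-- A `B`-linear operator whose leading term vanishes has image in `𝔪 (B ⊗̂ Y)`. -/
theorem mem_smul_top_of_iota [IsNoetherianRing B] (f : CTP B X →ₗ[B] CTP B Y)
    (hf : ∀ x, f (iota B X x) ∈ mpow B Y 1) (x : CTP B X) :
    f x ∈ (maximalIdeal B • ⊤ : Submodule B (CTP B Y)) := by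
  obtain ⟨z, hz⟩ := exists_eval_eq 1 x
  have hof : f (AdicCompletion.of _ _ z) ∈ (maximalIdeal B • ⊤ : Submodule B (CTP B Y)) := by
    clear hz
    induction z with
    | zero => simp
    | add z w hz hw => simpa using add_mem hz hw
    | tmul b v =>
      have h : (b ⊗ₜ[ℂ] v : B ⊗[ℂ] X) = b • ((1 : B) ⊗ₜ[ℂ] v) := by
        rw [TensorProduct.smul_tmul', smul_eq_mul, mul_one]
      rw [h, map_smul, map_smul]
      exact Submodule.smul_mem _ _ (mem_mpow_one.1 (hf v))
  have hsub : x - AdicCompletion.of _ _ z ∈ (maximalIdeal B • ⊤ : Submodule B (CTP B X)) := by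
    rw [← mem_mpow_one, mpow, LinearMap.mem_ker, map_sub, hz, AdicCompletion.eval_of]
    exact sub_self _
  have hmap : f (x - AdicCompletion.of _ _ z) ∈
      (maximalIdeal B • ⊤ : Submodule B (CTP B Y)) := by
    have := Submodule.mem_map_of_mem (f := f) hsub
    rw [Submodule.map_smul''] at this
    exact (smul_mono_right (maximalIdeal B) le_top :
      _ ≤ (maximalIdeal B • ⊤ : Submodule B (CTP B Y))) this
  simpa using add_mem hmap hof

end Hat

/-- A homological splitting provides projections `p`, `q` onto `H`, `R` and a homotopy `s`
with values in `R` which inverts `d` on `R` and vanishes on `H ⊔ R`. -/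
theorem exists_splitting_maps {V : Type*} [AddCommGroup V] [Module ℂ V]
    {H I R : Submodule ℂ V} {d : V →ₗ[ℂ] V}
    (hsup : H ⊔ I ⊔ R = ⊤)
    (hdisjH : Disjoint H (I ⊔ R)) (hdisjIR : Disjoint I R)
    (hI : I = LinearMap.range d)
    (hker : LinearMap.ker d = H ⊔ I) :
    ∃ p q s : V →ₗ[ℂ] V, (∀ v, p v ∈ H) ∧ (∀ v, q v ∈ R) ∧ (∀ v, s v ∈ R) ∧
      (∀ h ∈ H, p h = h) ∧ (∀ r ∈ R, p r = 0) ∧ (∀ i ∈ I, p i = 0) ∧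
      (∀ h ∈ H, q h = 0) ∧ (∀ r ∈ R, q r = r) ∧ (∀ i ∈ I, q i = 0) ∧
      (∀ h ∈ H, s h = 0) ∧ (∀ r ∈ R, s r = 0) ∧ (∀ r ∈ R, s (d r) = r) ∧
      p + q + d ∘ₗ s = LinearMap.id := by
  have hcH : IsCompl H (I ⊔ R) := ⟨hdisjH, codisjoint_iff.2 (by rw [← sup_assoc, hsup])⟩
  have hdR : Disjoint R (H ⊔ I) :=
    (hdisjIR.disjoint_sup_left_of_disjoint_sup_right hdisjH).symm
  have hcR : IsCompl R (H ⊔ I) := ⟨hdR, codisjoint_iff.2 (by rw [sup_comm, hsup])⟩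
  have hdisjI : Disjoint I (H ⊔ R) := by
    rw [sup_comm]
    exact Disjoint.disjoint_sup_right_of_disjoint_sup_left hdisjIR hdisjH.symm
  have hcI : IsCompl I (H ⊔ R) := ⟨hdisjI, codisjoint_iff.2 (by rw [← hsup]; ac_rfl)⟩
  obtain ⟨g, hg⟩ := d.rangeRestrict.exists_rightInverse_of_surjective d.range_rangeRestrict
  subst hI
  have hdg : ∀ i, d (g i) = i := fun i ↦ congrArg Subtype.val (LinearMap.congr_fun hg i)
  have hdH : ∀ h ∈ H, d h = 0 := fun h hh ↦ hker.ge (Submodule.mem_sup_left hh)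
  have hdI : ∀ i ∈ LinearMap.range d, d i = 0 := fun i hi ↦ hker.ge (Submodule.mem_sup_right hi)
  have hpH : ∀ h ∈ H, H.projection _ hcH h = h := fun h hh ↦
    Submodule.projection_apply_of_mem_left _ hh
  have hpI : ∀ i ∈ LinearMap.range d, H.projection _ hcH i = 0 := fun i hi ↦
    (Submodule.projection_apply_eq_zero_iff _).2 (Submodule.mem_sup_left hi)
  have hpR : ∀ r ∈ R, H.projection _ hcH r = 0 := fun r hr ↦
    (Submodule.projection_apply_eq_zero_iff _).2 (Submodule.mem_sup_right hr)
  have hqR : ∀ r ∈ R, R.projection _ hcR r = r := fun r hr ↦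
    Submodule.projection_apply_of_mem_left _ hr
  have hqker : ∀ v, d v = 0 → R.projection _ hcR v = 0 := fun v hv ↦
    (Submodule.projection_apply_eq_zero_iff _).2 (hker.le hv)
  have hπI : ∀ i (hi : i ∈ LinearMap.range d), Submodule.projectionOnto _ _ hcI i = ⟨i, hi⟩ :=
    fun i hi ↦ Submodule.projectionOnto_apply_of_mem_left _ hi
  have hπH : ∀ h ∈ H, Submodule.projectionOnto _ _ hcI h = 0 := fun h hh ↦
    (Submodule.projectionOnto_apply_eq_zero_iff _).2 (Submodule.mem_sup_left hh)
  have hπR : ∀ r ∈ R, Submodule.projectionOnto _ _ hcI r = 0 := fun r hr ↦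
    (Submodule.projectionOnto_apply_eq_zero_iff _).2 (Submodule.mem_sup_right hr)
  have hdec : ∀ v, ∃ h ∈ H, ∃ i ∈ LinearMap.range d, ∃ r ∈ R, v = h + i + r := by
    intro v
    obtain ⟨y, hy, r, hr, rfl⟩ := Submodule.mem_sup.1 (hsup.ge (Submodule.mem_top (x := v)))
    obtain ⟨h, hh, i, hi, rfl⟩ := Submodule.mem_sup.1 hy
    exact ⟨h, hh, i, hi, r, hr, rfl⟩
  have hdq : ∀ v, d (R.projection _ hcR v) = d v := by
    intro v
    obtain ⟨h, hh, i, hi, r, hr, rfl⟩ := hdec v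
    simp only [map_add, hqker h (hdH h hh), hqker i (hdI i hi), hqR r hr, hdH h hh, hdI i hi,
      map_zero]
  refine ⟨H.projection _ hcH, R.projection _ hcR,
    R.projection _ hcR ∘ₗ g ∘ₗ Submodule.projectionOnto _ _ hcI,
    Submodule.projection_apply_mem _, Submodule.projection_apply_mem _,
    fun v ↦ Submodule.projection_apply_mem _ _, hpH, hpR, hpI, fun h hh ↦ hqker h (hdH h hh), hqR,
    fun i hi ↦ hqker i (hdI i hi), fun h hh ↦ ?_, fun r hr ↦ ?_, fun r hr ↦ ?_, ?_⟩
  · simp [hπH h hh]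
  · simp [hπR r hr]
  · have h := hqker (g ⟨d r, r, rfl⟩ - r) (by rw [map_sub, hdg, sub_self])
    rw [map_sub, hqR r hr, sub_eq_zero] at h
    rw [LinearMap.comp_apply, LinearMap.comp_apply, hπI _ ⟨r, rfl⟩, h]
  · ext v
    obtain ⟨h, hh, i, hi, r, hr, rfl⟩ := hdec v
    simp only [LinearMap.add_apply, LinearMap.comp_apply, hdq, hdg, LinearMap.id_apply]
    simp only [map_add, hpH h hh, hpI i hi, hpR r hr, hqker h (hdH h hh), hqker i (hdI i hi),
      hqR r hr, hπH h hh, hπI i hi, hπR r hr]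
    simp only [add_zero, zero_add]
    abel

/-- Assume `d_q ∘ d_q = 0`, `D = 0` and `H` finite-dimensional over
ℂ.  Then the `B`-module `ker d_q / range d_q` is isomorphic to `B ⊗[ℂ] H (≅ B ⊗̂ H)`;
in particular it is a finitely generated free, hence projective, `B`-module. -/
theorem cohomology_projective_of_D_eq_zero
    (B : Type) [CommRing B] [Algebra ℂ B] [IsNoetherianRing B] [IsLocalRing B]
    [IsAdicComplete (maximalIdeal B) B]
    (hres : Function.Bijective (algebraMap ℂ (ResidueField B)))
    (V : Type) [AddCommGroup V] [Module ℂ V]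
    (H I R : Submodule ℂ V) (d : V →ₗ[ℂ] V)
    (hsup : H ⊔ I ⊔ R = ⊤)
    (hdisjH : Disjoint H (I ⊔ R)) (hdisjIR : Disjoint I R)
    (hI : I = LinearMap.range d)
    (hker : LinearMap.ker d = H ⊔ I)
    (dq : CTP B V →ₗ[B] CTP B V)
    (hlead : ∀ v : V, dq (iota B V v) - iota B V (d v) ∈ mpow B V 1)
    (D E F : CTP B V →ₗ[B] CTP B V)
    (hD : ∀ h ∈ csub B V H, D h ∈ csub B V H)
    (hE : ∀ h ∈ csub B V H, E h ∈ csub B V R)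
    (hF : ∀ h ∈ csub B V H, F h ∈ csub B V R)
    (hDEF : ∀ h ∈ csub B V H, dq h = D h + dq (E h) + F h)
    (hdq2 : ∀ x : CTP B V, dq (dq x) = 0)
    (hD0 : ∀ h ∈ csub B V H, D h = 0)
    [FiniteDimensional ℂ ↥H] :
    Nonempty (LinCohomology B (CTP B V) dq ≃ₗ[B] (B ⊗[ℂ] ↥H)) ∧
    Module.Finite B (LinCohomology B (CTP B V) dq) ∧
    Module.Free B (LinCohomology B (CTP B V) dq) ∧
    Module.Projective B (LinCohomology B (CTP B V) dq) := by
  obtain ⟨p, q, s, hpmem, hqmem, hsmem, hpH, hpR, hpI, hqH, hqR, hqI, hsH, hsR, hsd, hsum⟩ :=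
    exists_splitting_maps hsup hdisjH hdisjIR hI hker
  have hdmem : ∀ v, d v ∈ I := fun v ↦ hI.ge ⟨v, rfl⟩
  have hcomplete : IsAdicComplete (maximalIdeal B) (CTP B V) :=
    AdicCompletion.isAdicComplete (maximalIdeal B).fg_of_isNoetherianRing
  have hlead' := mem_smul_top_of_iota (dq - hat B d) fun v ↦ by
    rw [LinearMap.sub_apply, hat_iota]
    exact hlead v
  let Φ : CTP B V →ₗ[B] CTP B V := hat B p + hat B q + dq ∘ₗ hat B s
  have hΦ : ∀ x, Φ x = hat B p x + hat B q x + dq (hat B s x) := fun _ ↦ rfl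
  obtain ⟨hΦinj, hΦsurj⟩ : Function.Bijective Φ := by
    refine bijective_of_sub_self_mem_smul_top (maximalIdeal B) Φ fun x ↦ ?_
    convert hlead' (hat B s x) using 1
    have hx := hat_id_apply x
    rw [← hsum, hat_add_apply, hat_add_apply, ← hat_hat] at hx
    nth_rewrite 2 [← hx]
    rw [hΦ, LinearMap.sub_apply]
    abel
  have hΦd : ∀ r ∈ csub B V R, Φ (hat B d r) = dq r := by
    intro r hr
    rw [hΦ, hat_hat, hat_hat, hat_hat,
      hat_eq_zero_of_mem_csub (p ∘ₗ d) (fun v _ ↦ hpI _ (hdmem v)) hr,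
      hat_eq_zero_of_mem_csub (q ∘ₗ d) (fun v _ ↦ hqI _ (hdmem v)) hr,
      hat_eq_self_of_mem_csub (s ∘ₗ d) hsd hr, zero_add, zero_add]
  have hΦH : ∀ h ∈ csub B V H, Φ h = h := by
    intro h hh
    rw [hΦ, hat_eq_self_of_mem_csub p hpH hh, hat_eq_zero_of_mem_csub q hqH hh,
      hat_eq_zero_of_mem_csub s hsH hh, map_zero, add_zero, add_zero]
  have hΦR : ∀ r ∈ csub B V R, Φ r = r := by
    intro r hr
    rw [hΦ, hat_eq_zero_of_mem_csub p hpR hr, hat_eq_self_of_mem_csub q hqR hr,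
      hat_eq_zero_of_mem_csub s hsR hr, map_zero, add_zero, zero_add]
  have hdqR : ∀ r ∈ csub B V R, dq r = 0 → r = 0 := by
    intro r hr h0
    have h1 : hat B d r = 0 := hΦinj (by rw [hΦd r hr, h0, map_zero])
    rw [← hat_eq_self_of_mem_csub (s ∘ₗ d) hsd hr, ← hat_hat, h1, map_zero]
  have hdqH : ∀ h ∈ csub B V H, dq h = dq (E h) := by
    intro h hh
    have h1 := hDEF h hh
    have h2 : F h = 0 := by
      refine hdqR _ (hF h hh) ?_
      have h3 := congrArg dq h1
      rwa [hD0 h hh, zero_add, map_add, hdq2, hdq2, zero_add, eq_comm] at h3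
    rwa [hD0 h hh, h2, zero_add, add_zero] at h1
  have hdec : ∀ x, ∃ h ∈ csub B V H, ∃ r ∈ csub B V R, ∃ y, x = h + r + dq y := by
    intro x
    obtain ⟨z, rfl⟩ := hΦsurj x
    exact ⟨_, hat_mem_csub p hpmem z, _, hat_mem_csub q hqmem z, _, hΦ z⟩
  obtain ⟨e₁⟩ := nonempty_linCohomology_equiv dq E (csub B V H)
    (fun h hh ↦ by rw [map_sub, hdqH h hh, sub_self])
    (by
      intro h hh y hy
      obtain ⟨h', hh', r', hr', y', rfl⟩ := hdec y
      rw [map_add, map_add, hdq2, add_zero, hdqH h' hh', ← map_add] at hy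
      have hr := add_mem (hE h' hh') hr'
      have h0 : h - E h - hat B d (E h' + r') = 0 := by
        refine hΦinj ?_
        rw [map_sub, map_sub, hΦH h hh, hΦR _ (hE h hh), hΦd _ hr, hy, sub_self, map_zero]
      have h1 := congrArg (hat B p) h0
      rwa [map_sub, map_sub, hat_eq_self_of_mem_csub p hpH hh,
        hat_eq_zero_of_mem_csub p hpR (hE h hh), hat_hat,
        hat_eq_zero_of_mem_csub (p ∘ₗ d) (fun v _ ↦ hpI _ (hdmem v)) hr, map_zero, sub_zero,
        sub_zero] at h1)
    (by
      intro x hx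
      obtain ⟨h, hh, r, hr, y, rfl⟩ := hdec x
      rw [map_add, map_add, hdq2, add_zero, hdqH h hh, ← map_add] at hx
      have h0 := hdqR _ (add_mem (hE h hh) hr) hx
      exact ⟨h, hh, y, by rw [eq_neg_of_add_eq_zero_right h0, sub_eq_add_neg]⟩)
  obtain ⟨e₂⟩ := nonempty_csub_equiv (B := B) H
  obtain ⟨e₃⟩ := nonempty_ctp_equiv (B := B) (X := H)
  let e := e₁ ≪≫ₗ e₂ ≪≫ₗ e₃
  have hfree : Module.Free B (LinCohomology B (CTP B V) dq) := Module.Free.of_equiv e.symm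
  exact ⟨⟨e⟩, Module.Finite.equiv e.symm, hfree, inferInstance⟩
end
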